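/- Let τ > 0 be real and let k be a nonnegative integer. Then the following identity between complex numbers holds: ∑_{n=0}^{k} [ Γ(1/2+n)² · Γ(3/2+n) · (1+τ²) · sech(π/(2τ)) / ( 2√π · τ³ · n! · Γ(3/2+n−i/(2τ)) · Γ(3/2+n+i/(2τ)) ) ] · [ Γ(1/2+k−n) / ( 2(k+1) · √π · (k−n)! ) ] = (1/(2√π·τ)) · ( Γ(1/2+k)/Γ(2+k) ) · ∑_{j=0}^{k} [ (1/2)ⱼ (1/2)ⱼ (3/2)ⱼ (−k)ⱼ / ( (1/2−k)ⱼ (3/2−i/(2τ))ⱼ (3/2+i/(2τ))ⱼ · j! ) ]. -/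

import Mathlib

open Real

/-- The Pochhammer symbol (ascending factorial) `(x)ⱼ` for complex `x`. -/
noncomputable def poch (x : ℂ) (j : ℕ) : ℂ := (ascPochhammer ℂ j).eval x

theorem gamma_add_natCast_eq_poch (s : ℂ) (hs : 0 < s.re) (n : ℕ) :
    Complex.Gamma (s + n) = poch s n * Complex.Gamma s := by
  induction n with
  | zero => simp [poch]
  | succ n ih =>
    have hne : s + n ≠ 0 := by
      intro h
      have := congrArg Complex.re h
      simp only [Complex.add_re, Complex.natCast_re, Complex.zero_re] at this
      have : (0 : ℝ) ≤ n := n.cast_nonneg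
      linarith
    unfold poch at ih ⊢
    rw [ascPochhammer_succ_eval, Nat.cast_succ, ← add_assoc, Complex.Gamma_add_one _ hne, ih]
    ring

theorem poch_ne_zero (s : ℂ) (hs : 0 < s.re) (n : ℕ) : poch s n ≠ 0 := by
  intro h
  have h1 := gamma_add_natCast_eq_poch s hs n
  rw [h, zero_mul] at h1
  refine Complex.Gamma_ne_zero_of_re_pos ?_ h1
  simp only [Complex.add_re, Complex.natCast_re]
  positivity

theorem poch_one_sub_sub (s : ℂ) (n : ℕ) : poch (1 - s - n) n = (-1) ^ n * poch s n := by
  rw [poch, poch, show 1 - s - n = -(s + n - 1) by ring,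
    ascPochhammer_eval_neg_eq_descPochhammer, descPochhammer_eval_eq_ascPochhammer,
    show s + n - 1 - n + 1 = s by ring]

theorem poch_neg_div_poch_half_sub {k n : ℕ} (hn : n ≤ k) :
    Complex.Gamma (1 / 2 + k) * (poch (-(k : ℂ)) n / poch (1 / 2 - k) n) / k.factorial =
      Complex.Gamma (1 / 2 + ((k - n : ℕ) : ℂ)) / (k - n).factorial := by
  obtain ⟨m, rfl⟩ := Nat.exists_eq_add_of_le' hn
  rw [Nat.add_sub_cancel]
  have hre : 0 < (1 / 2 + (m : ℂ)).re := by
    simp only [Complex.add_re, Complex.natCast_re]; norm_num; positivity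
  have hre' : 0 < (1 + (m : ℂ)).re := by
    simp only [Complex.add_re, Complex.natCast_re, Complex.one_re]; positivity
  have hfac : ((m + n).factorial : ℂ) = poch (1 + m) n * m.factorial := by
    rw [← Complex.Gamma_nat_eq_factorial, ← Complex.Gamma_nat_eq_factorial,
      add_comm (m : ℂ) 1, ← gamma_add_natCast_eq_poch _ hre']
    push_cast
    ring_nf
  have hgam : Complex.Gamma (1 / 2 + ((m + n : ℕ) : ℂ)) =
      poch (1 / 2 + m) n * Complex.Gamma (1 / 2 + m) := by
    rw [← gamma_add_natCast_eq_poch _ hre]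
    push_cast
    ring_nf
  have h1 : poch (-((m + n : ℕ) : ℂ)) n = (-1) ^ n * poch (1 + m) n := by
    rw [← poch_one_sub_sub]; push_cast; ring_nf
  have h2 : poch (1 / 2 - ((m + n : ℕ) : ℂ)) n = (-1) ^ n * poch (1 / 2 + m) n := by
    rw [← poch_one_sub_sub]; push_cast; ring_nf
  have hp := poch_ne_zero _ hre n
  have hp' := poch_ne_zero _ hre' n
  rw [hfac, hgam, h1, h2]
  generalize poch (1 / 2 + m) n = p at *
  generalize Complex.Gamma (1 / 2 + m) = g at *
  field_simp

theorem gamma_three_halves_sub_mul_add (y : ℝ) :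
    Complex.Gamma (3 / 2 - y * Complex.I) * Complex.Gamma (3 / 2 + y * Complex.I) =
      (1 / 4 + y ^ 2) * (π / (Real.cosh (π * y) : ℂ)) := by
  have step : ∀ t : ℝ, Complex.Gamma (3 / 2 + t * Complex.I) =
      (1 / 2 + t * Complex.I) * Complex.Gamma (1 / 2 + t * Complex.I) := by
    intro t
    rw [← Complex.Gamma_add_one]
    · ring_nf
    · intro h
      have := congrArg Complex.re h
      norm_num at this
  have hrefl := Complex.Gamma_mul_Gamma_one_sub (1 / 2 + y * Complex.I)
  have hsin : Complex.sin (π * (1 / 2 + y * Complex.I)) = (Real.cosh (π * y) : ℂ) := by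
    rw [show (π : ℂ) * (1 / 2 + y * Complex.I) = (π * y : ℂ) * Complex.I + π / 2 by ring,
      Complex.sin_add_pi_div_two, Complex.cos_mul_I]
    push_cast
    rfl
  rw [hsin, show 1 - (1 / 2 + y * Complex.I) = 1 / 2 + ((-y : ℝ) : ℂ) * Complex.I by
    push_cast; ring] at hrefl
  rw [show 3 / 2 - y * Complex.I = 3 / 2 + ((-y : ℝ) : ℂ) * Complex.I by push_cast; ring,
    step, step, ← hrefl]
  push_cast
  linear_combination (-(y : ℂ) ^ 2 * Complex.Gamma (1 / 2 + -(y : ℂ) * Complex.I) *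
    Complex.Gamma (1 / 2 + y * Complex.I)) * Complex.I_sq

theorem cauchy_product_gamma_hypergeometric_identity
    (τ : ℝ) (hτ : 0 < τ) (k : ℕ) :
    ∑ n ∈ Finset.range (k + 1),
      (Complex.Gamma (1 / 2 + (n : ℂ)) ^ 2 * Complex.Gamma (3 / 2 + (n : ℂ)) *
            (1 + (τ : ℂ) ^ 2) * (1 / (Real.cosh (π / (2 * τ)) : ℂ)) /
          (2 * (Real.sqrt π : ℂ) * (τ : ℂ) ^ 3 * (n.factorial : ℂ) *
            Complex.Gamma (3 / 2 + (n : ℂ) - Complex.I / (2 * τ)) *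
            Complex.Gamma (3 / 2 + (n : ℂ) + Complex.I / (2 * τ)))) *
        (Complex.Gamma (1 / 2 + ((k - n : ℕ) : ℂ)) /
          (2 * ((k : ℂ) + 1) * (Real.sqrt π : ℂ) * ((k - n).factorial : ℂ))) =
    1 / (2 * (Real.sqrt π : ℂ) * (τ : ℂ)) *
      (Complex.Gamma (1 / 2 + (k : ℂ)) / Complex.Gamma (2 + (k : ℂ))) *
      ∑ j ∈ Finset.range (k + 1),
        poch (1 / 2) j * poch (1 / 2) j * poch (3 / 2) j * poch (-(k : ℂ)) j /
          (poch (1 / 2 - (k : ℂ)) j * poch (3 / 2 - Complex.I / (2 * τ)) j *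
            poch (3 / 2 + Complex.I / (2 * τ)) j * (j.factorial : ℂ)) := by
  have hτ' : (τ : ℂ) ≠ 0 := by exact_mod_cast hτ.ne'
  have hτ2 : (1 : ℂ) + τ ^ 2 ≠ 0 := by
    have : (1 : ℝ) + τ ^ 2 ≠ 0 := by positivity
    exact_mod_cast this
  have hsq : ((√π : ℝ) : ℂ) ^ 2 = π := by
    rw [← Complex.ofReal_pow, Real.sq_sqrt pi_pos.le]
  have hcosh : (Real.cosh (π / (2 * τ)) : ℂ) ≠ 0 := by
    exact_mod_cast (Real.cosh_pos _).ne'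
  have hy : Complex.I / (2 * τ) = ((1 / (2 * τ) : ℝ) : ℂ) * Complex.I := by
    push_cast; ring
  have hre1 : 0 < (3 / 2 - Complex.I / (2 * τ)).re := by rw [hy]; norm_num
  have hre2 : 0 < (3 / 2 + Complex.I / (2 * τ)).re := by rw [hy]; norm_num
  have hprod : Complex.Gamma (3 / 2 - Complex.I / (2 * τ)) *
      Complex.Gamma (3 / 2 + Complex.I / (2 * τ)) =
        (1 + τ ^ 2) / (4 * τ ^ 2) * (π / (Real.cosh (π / (2 * τ)) : ℂ)) := by
    rw [hy, gamma_three_halves_sub_mul_add, mul_one_div]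
    congr 1
    push_cast
    field_simp
    ring
  have hhalf : Complex.Gamma (1 / 2) = ((√π : ℝ) : ℂ) := by
    rw [Complex.Gamma_one_half_eq, Real.sqrt_eq_rpow, Complex.ofReal_cpow pi_pos.le]
    norm_num
  have hthree : Complex.Gamma (3 / 2) = ((√π : ℝ) : ℂ) / 2 := by
    rw [show (3 / 2 : ℂ) = 1 / 2 + 1 by norm_num, Complex.Gamma_add_one _ (by norm_num), hhalf]
    ring
  have hgk : Complex.Gamma (2 + (k : ℂ)) = (k + 1) * k.factorial := by
    rw [show (2 : ℂ) + k = ((k + 1 : ℕ) : ℂ) + 1 by push_cast; ring,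
      Complex.Gamma_nat_eq_factorial, Nat.factorial_succ]
    push_cast
    rfl
  rw [Finset.mul_sum]
  refine Finset.sum_congr rfl fun n hn => ?_
  have hratio := poch_neg_div_poch_half_sub (Nat.lt_succ_iff.mp (Finset.mem_range.mp hn))
  rw [hgk,
    show 3 / 2 + (n : ℂ) - Complex.I / (2 * τ) = 3 / 2 - Complex.I / (2 * τ) + n by ring,
    show 3 / 2 + (n : ℂ) + Complex.I / (2 * τ) = 3 / 2 + Complex.I / (2 * τ) + n by ring,
    gamma_add_natCast_eq_poch _ hre1, gamma_add_natCast_eq_poch _ hre2,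
    gamma_add_natCast_eq_poch (1 / 2) (by norm_num) n,
    gamma_add_natCast_eq_poch (3 / 2) (by norm_num) n, hhalf, hthree]
  generalize Complex.Gamma (3 / 2 - Complex.I / (2 * τ)) = G₁ at *
  generalize Complex.Gamma (3 / 2 + Complex.I / (2 * τ)) = G₂ at *
  generalize poch (3 / 2 - Complex.I / (2 * τ)) n = p₁ at *
  generalize poch (3 / 2 + Complex.I / (2 * τ)) n = p₂ at *
  generalize (Real.cosh (π / (2 * τ)) : ℂ) = c at *
  generalize ((√π : ℝ) : ℂ) = r at *
  generalize poch (1 / 2) n = a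
  generalize poch (3 / 2) n = b
  have hpref : r ^ 2 * (1 + (τ : ℂ) ^ 2) * (1 / c) / (τ ^ 3 * (G₁ * G₂)) = 4 / τ := by
    rw [hprod, hsq]
    field_simp
  calc _ = (r ^ 2 * (1 + (τ : ℂ) ^ 2) * (1 / c) / (τ ^ 3 * (G₁ * G₂))) *
        (a ^ 2 * b / (p₁ * p₂ * n.factorial)) / (8 * r * (k + 1)) *
        (Complex.Gamma (1 / 2 + ((k - n : ℕ) : ℂ)) / (k - n).factorial) := by
        field_simp
        ring
    _ = _ := by
        rw [hpref, ← hratio]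
        simp only [div_eq_mul_inv, mul_inv]
        ring
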